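/- arXiv:2102.04401 — 2 statements merged into one kernel-verified Lean document; each statement's English description precedes it below -/
import Mathlib

section
/- There exist constants c > 0 and ε₀ > 0 such that for every ε ∈ (0, ε₀), any polynomial p : ℝ → ℝ satisfying E_{x∼γ₁}[|sign(x) − p(x)|] ≤ ε must have degree at least c/ε², where sign(x) = 1 for x ≥ 0 and sign(x) = −1 for x < 0. -/
open MeasureTheory ProbabilityTheory

/-- The sign function, taking value `1` on `[0, ∞)` and `-1` on `(−∞, 0)`. -/
noncomputable def sgn (u : ℝ) : ℝ := if 0 ≤ u then 1 else -1

open Polynomial in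
lemma abs_eval_natCast_le_three_pow {P : ℝ[X]} {n : ℕ} (hP : P.natDegree ≤ n) {M : ℝ}
    (hM : ∀ j : ℕ, j ≤ n → |P.eval (j : ℝ)| ≤ M) (m : ℕ) :
    |P.eval (m : ℝ)| ≤ 3 ^ m * M := by
  have hM0 : 0 ≤ M := (abs_nonneg _).trans (hM 0 (Nat.zero_le n))
  have hdiff (k : ℕ) : |(fwdDiff (1 : ℝ))^[k] P.eval 0| ≤ 2 ^ k * M := by
    rcases le_or_gt k n with hk | hk
    · rw [fwdDiff_iter_eq_sum_shift]
      refine (Finset.abs_sum_le_sum_abs _ _).trans ?_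
      have hsum : (2 : ℝ) ^ k * M = ∑ j ∈ Finset.range (k + 1), (k.choose j : ℝ) * M := by
        rw [← Finset.sum_mul, ← Nat.cast_sum, Nat.sum_range_choose]
        push_cast
        rfl
      rw [hsum]
      refine Finset.sum_le_sum fun j hj => ?_
      have hj' : j ≤ n := (Nat.lt_succ_iff.mp (Finset.mem_range.mp hj)).trans hk
      have := hM j hj'
      simp only [zsmul_eq_mul, abs_mul, zero_add, nsmul_eq_mul, mul_one]
      push_cast
      rw [abs_mul, abs_pow, abs_neg, abs_one, one_pow, one_mul, Nat.abs_cast]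
      gcongr
    · rw [Polynomial.fwdDiff_iter_eq_zero_of_degree_lt (hP.trans_lt hk)]
      simp only [Pi.zero_apply, abs_zero]
      positivity
  have hshift := shift_eq_sum_fwdDiff_iter (1 : ℝ) P.eval m 0
  simp only [zero_add, nsmul_eq_mul, mul_one] at hshift
  rw [hshift]
  refine (Finset.abs_sum_le_sum_abs _ _).trans ?_
  have hpow : (3 : ℝ) ^ m = ∑ k ∈ Finset.range (m + 1), 2 ^ k * (m.choose k : ℝ) := by
    have := add_pow (2 : ℝ) 1 m
    norm_num at this
    exact this
  rw [hpow, Finset.sum_mul]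
  refine Finset.sum_le_sum fun k _ => ?_
  rw [abs_mul, Nat.abs_cast, mul_comm (2 ^ k : ℝ), mul_assoc]
  exact mul_le_mul_of_nonneg_left (hdiff k) (Nat.cast_nonneg _)

lemma integrable_pow_gaussianReal (k : ℕ) :
    Integrable (fun x : ℝ => x ^ k) (gaussianReal 0 1) := by
  have h : MemLp id k (gaussianReal 0 1) :=
    memLp_id_gaussianReal' k (ENNReal.natCast_ne_top k)
  refine h.integrable_norm_pow'.mono' (by fun_prop) (ae_of_all _ fun x => ?_)
  simp

lemma integrable_eval_gaussianReal (p : Polynomial ℝ) :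
    Integrable (fun x : ℝ => p.eval x) (gaussianReal 0 1) := by
  simp_rw [Polynomial.eval_eq_sum_range]
  exact integrable_finsetSum _ fun k _ => (integrable_pow_gaussianReal k).const_mul _

lemma integrable_mul_sin {f : ℝ → ℝ} {μ : Measure ℝ} (hf : Integrable f μ) (t : ℝ) :
    Integrable (fun x => f x * Real.sin (t * x)) μ :=
  hf.mul_bdd (c := 1) (by fun_prop) (ae_of_all _ fun x => Real.abs_sin_le_one _)

lemma integrable_mul_cos {f : ℝ → ℝ} {μ : Measure ℝ} (hf : Integrable f μ) (t : ℝ) :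
    Integrable (fun x => f x * Real.cos (t * x)) μ :=
  hf.mul_bdd (c := 1) (by fun_prop) (ae_of_all _ fun x => Real.abs_cos_le_one _)

lemma exists_iteratedDeriv_charFun_gaussianReal (k : ℕ) :
    ∃ S : Polynomial ℝ, S.natDegree ≤ k ∧
      iteratedDeriv k (charFun (gaussianReal 0 1)) =
        fun t : ℝ => ((S.eval t * Real.exp (-t ^ 2 / 2) : ℝ) : ℂ) := by
  induction k with
  | zero =>
    refine ⟨1, by simp, ?_⟩
    funext t
    simp [charFun_gaussianReal, neg_div]
  | succ k ih =>
    obtain ⟨S, hS, hd⟩ := ih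
    refine ⟨Polynomial.derivative S - Polynomial.X * S, ?_, ?_⟩
    · refine (Polynomial.natDegree_sub_le _ _).trans (max_le ?_ ?_)
      · exact (Polynomial.natDegree_derivative_le S).trans (by omega)
      · refine Polynomial.natDegree_mul_le.trans ?_
        rw [Polynomial.natDegree_X]
        omega
    · funext t
      rw [iteratedDeriv_succ, hd]
      have hexp : HasDerivAt (fun t : ℝ => Real.exp (-t ^ 2 / 2))
          (Real.exp (-t ^ 2 / 2) * (-t)) t := by
        have h := (((hasDerivAt_id t).pow 2).neg.div_const 2).exp
        convert! h using 1
        simp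
        ring
      have h := ((S.hasDerivAt t).mul hexp).ofReal_comp
      refine h.deriv.trans ?_
      congr 1
      simp
      ring

lemma exists_integral_pow_mul_sin_gaussianReal (k : ℕ) :
    ∃ R : Polynomial ℝ, R.natDegree ≤ k ∧ ∀ t : ℝ,
      ∫ x, x ^ k * Real.sin (t * x) ∂(gaussianReal 0 1) =
        R.eval t * Real.exp (-t ^ 2 / 2) := by
  obtain ⟨S, hS, hd⟩ := exists_iteratedDeriv_charFun_gaussianReal k
  refine ⟨Polynomial.C ((-Complex.I) ^ k).im * S,
    (Polynomial.natDegree_C_mul_le _ _).trans hS, fun t => ?_⟩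
  have h1 := congrFun hd t
  rw [iteratedDeriv_charFun (memLp_id_gaussianReal' k (ENNReal.natCast_ne_top k))] at h1
  have h2 : ∫ x : ℝ, (x : ℂ) ^ k * Complex.exp (t * x * Complex.I) ∂(gaussianReal 0 1) =
      (-Complex.I) ^ k * ((S.eval t * Real.exp (-t ^ 2 / 2) : ℝ) : ℂ) := by
    rw [← h1, ← mul_assoc, ← mul_pow]
    simp
  have h_integrable : Integrable (fun x : ℝ => (x : ℂ) ^ k * Complex.exp (t * x * Complex.I))
      (gaussianReal 0 1) := by
    refine Integrable.mul_bdd (c := 1) ?_ (by fun_prop) (ae_of_all _ fun x => ?_)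
    · simpa using (integrable_pow_gaussianReal k).ofReal (𝕜 := ℂ)
    · rw [← Complex.ofReal_mul, Complex.norm_exp_ofReal_mul_I]
  have h3 := congrArg Complex.im h2
  rw [Complex.im_mul_ofReal, ← RCLike.im_eq_complex_im, ← integral_im h_integrable] at h3
  simp only [Polynomial.eval_mul, Polynomial.eval_C]
  rw [mul_assoc]
  refine Eq.trans (integral_congr_ae (ae_of_all _ fun x => ?_)) h3
  rw [← Complex.ofReal_mul, ← Complex.ofReal_pow]
  simp only [RCLike.im_eq_complex_im, Complex.im_ofReal_mul, Complex.exp_ofReal_mul_I_im]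

lemma exists_integral_eval_mul_sin_gaussianReal (p : Polynomial ℝ) :
    ∃ R : Polynomial ℝ, R.natDegree ≤ p.natDegree ∧ ∀ t : ℝ,
      ∫ x, p.eval x * Real.sin (t * x) ∂(gaussianReal 0 1) =
        R.eval t * Real.exp (-t ^ 2 / 2) := by
  choose R hR hRt using exists_integral_pow_mul_sin_gaussianReal
  refine ⟨∑ k ∈ Finset.range (p.natDegree + 1), Polynomial.C (p.coeff k) * R k, ?_, fun t => ?_⟩
  · refine Polynomial.natDegree_sum_le_of_forall_le _ _ fun k hk => ?_
    exact (Polynomial.natDegree_C_mul_le _ _).trans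
      ((hR k).trans (Nat.lt_succ_iff.mp (Finset.mem_range.mp hk)))
  · simp_rw [Polynomial.eval_eq_sum_range (p := p), Finset.sum_mul, mul_assoc]
    rw [integral_finsetSum _ fun k _ =>
      (integrable_mul_sin (integrable_pow_gaussianReal k) t).const_mul _]
    simp_rw [integral_const_mul, hRt]
    simp [Polynomial.eval_finsetSum, Finset.sum_mul, mul_assoc]

/-- A polynomial has exponentially small sine transform at frequencies `8 √n`
once `n` exceeds its degree. -/
lemma abs_integral_eval_mul_sin_le (p : Polynomial ℝ) {n : ℕ} (hn : p.natDegree < n) :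
    |∫ x, p.eval x * Real.sin (8 * √n * x) ∂(gaussianReal 0 1)| ≤
      Real.exp (-(15 * n)) * ∫ x, |p.eval x| ∂(gaussianReal 0 1) := by
  obtain ⟨R, hR, hRt⟩ := exists_integral_eval_mul_sin_gaussianReal p
  set B := ∫ x, |p.eval x| ∂(gaussianReal 0 1)
  have hB : 0 ≤ B := integral_nonneg fun x => abs_nonneg _
  have hn0 : (0 : ℝ) < n := by exact_mod_cast (Nat.zero_le _).trans_lt hn
  have hs : 0 < √(n : ℝ) := Real.sqrt_pos.mpr hn0
  have hsq : √(n : ℝ) ^ 2 = n := Real.sq_sqrt hn0.le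
  have hbound (t : ℝ) : |R.eval t| ≤ Real.exp (t ^ 2 / 2) * B := by
    have h1 : |R.eval t * Real.exp (-t ^ 2 / 2)| ≤ B := by
      rw [← hRt]
      refine abs_integral_le_integral_abs.trans ?_
      refine integral_mono_of_nonneg (ae_of_all _ fun x => abs_nonneg _)
        (integrable_eval_gaussianReal p).abs (ae_of_all _ fun x => ?_)
      simp only [abs_mul]
      exact mul_le_of_le_one_right (abs_nonneg _) (Real.abs_sin_le_one _)
    rw [abs_mul, Real.abs_exp, neg_div, Real.exp_neg] at h1
    rwa [← div_eq_mul_inv, div_le_iff₀ (Real.exp_pos _), mul_comm] at h1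
  have hgrow := abs_eval_natCast_le_three_pow
    (P := R.comp (Polynomial.C (√(n : ℝ))⁻¹ * Polynomial.X)) (n := n)
    (M := Real.exp (n / 2) * B) ?_ ?_ (8 * n)
  · have harg : (√(n : ℝ))⁻¹ * ((8 * n : ℕ) : ℝ) = 8 * √n := by
      push_cast
      nth_rewrite 2 [← hsq]
      field_simp
    simp only [Polynomial.eval_comp, Polynomial.eval_mul, Polynomial.eval_C,
      Polynomial.eval_X, harg] at hgrow
    rw [hRt, abs_mul, Real.abs_exp]
    have h3 : (3 : ℝ) ^ (8 * n) ≤ Real.exp (16 * n) := by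
      have h : (3 : ℝ) ≤ Real.exp 2 := by
        have := Real.add_one_le_exp (2 : ℝ)
        linarith
      calc (3 : ℝ) ^ (8 * n) ≤ Real.exp 2 ^ (8 * n) := by gcongr
        _ = Real.exp (16 * n) := by
          rw [← Real.exp_nat_mul]
          push_cast
          ring_nf
    calc |R.eval (8 * √n)| * Real.exp (-(8 * √n) ^ 2 / 2)
        ≤ (Real.exp (16 * n) * (Real.exp (n / 2) * B)) * Real.exp (-(8 * √n) ^ 2 / 2) := by
          gcongr
          exact hgrow.trans (by gcongr)
      _ = Real.exp (16 * n + n / 2 + -(8 * √n) ^ 2 / 2) * B := by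
          rw [Real.exp_add, Real.exp_add]
          ring
      _ ≤ Real.exp (-(15 * n)) * B := by
          gcongr
          nlinarith
  · refine Polynomial.natDegree_comp_le.trans ?_
    have h1 : (Polynomial.C (√(n : ℝ))⁻¹ * Polynomial.X).natDegree ≤ 1 :=
      (Polynomial.natDegree_C_mul_le _ _).trans Polynomial.natDegree_X_le
    nlinarith
  · intro j hj
    simp only [Polynomial.eval_comp, Polynomial.eval_mul, Polynomial.eval_C, Polynomial.eval_X]
    refine (hbound _).trans ?_
    gcongr
    rw [mul_pow, inv_pow, hsq, inv_mul_le_iff₀ hn0]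
    have : (j : ℝ) ≤ n := by exact_mod_cast hj
    nlinarith [Nat.cast_nonneg (α := ℝ) j]

lemma integrable_gaussianPDFReal_mul {f : ℝ → ℝ} (hf : Integrable f (gaussianReal 0 1)) :
    Integrable (fun x => gaussianPDFReal 0 1 x * f x) := by
  rw [gaussianReal_of_var_ne_zero 0 one_ne_zero, integrable_withDensity_iff_integrable_smul'
    (measurable_gaussianPDF 0 1) (ae_of_all _ fun _ => gaussianPDF_lt_top)] at hf
  simpa [toReal_gaussianPDF] using hf

lemma integral_sq_gaussianReal : ∫ x, x ^ 2 ∂(gaussianReal 0 1) = 1 := by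
  rw [← variance_of_integral_eq_zero (X := fun x : ℝ => x) (by fun_prop) (by simp)]
  simp

lemma hasDerivAt_gaussianPDFReal (x : ℝ) :
    HasDerivAt (gaussianPDFReal 0 1) (-x * gaussianPDFReal 0 1 x) x := by
  have h := ((((hasDerivAt_id x).pow 2).neg.div_const 2).exp).const_mul (√(2 * Real.pi))⁻¹
  convert! h using 1
  · funext y
    simp [gaussianPDFReal]
  · simp [gaussianPDFReal]
    ring

lemma setIntegral_Ioi_gaussianPDFReal_mul_sin_ge {t : ℝ} (ht : 0 < t) :
    gaussianPDFReal 0 1 0 / t - 2 / t ^ 2 ≤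
      ∫ x in Set.Ioi 0, gaussianPDFReal 0 1 x * Real.sin (t * x) := by
  set φ := gaussianPDFReal 0 1 with hφ
  have i0 : Integrable φ := integrable_gaussianPDFReal 0 1
  have i1 : Integrable (fun x => φ x * x) := by
    simpa using integrable_gaussianPDFReal_mul (integrable_pow_gaussianReal 1)
  have i2 : Integrable (fun x => φ x * x ^ 2) :=
    integrable_gaussianPDFReal_mul (integrable_pow_gaussianReal 2)
  set G : ℝ → ℝ := fun x => -(φ x * Real.cos (t * x)) / t - φ x * x * Real.sin (t * x) / t ^ 2
  set H : ℝ → ℝ := fun x => (φ x - φ x * x ^ 2) * Real.sin (t * x) / t ^ 2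
  have iH : Integrable H := (integrable_mul_sin (i0.sub i2) t).div_const _
  have iS : Integrable (fun x => φ x * Real.sin (t * x)) := integrable_mul_sin i0 t
  have iG : Integrable G :=
    ((integrable_mul_cos i0 t).neg.div_const _).sub ((integrable_mul_sin i1 t).div_const _)
  have hG (x : ℝ) : HasDerivAt G (φ x * Real.sin (t * x) - H x) x := by
    have hx : HasDerivAt (fun x => t * x) t x := by simpa using (hasDerivAt_id x).const_mul t
    have h := (((hasDerivAt_gaussianPDFReal x).mul hx.cos).neg.div_const t).sub
      ((((hasDerivAt_gaussianPDFReal x).mul (hasDerivAt_id x)).mul hx.sin).div_const (t ^ 2))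
    convert! h using 1
    simp only [H, Pi.mul_apply, id, ← hφ]
    field_simp
    ring
  have hlim := tendsto_zero_of_hasDerivAt_of_integrableOn_Ioi (a := 0) (fun x _ => hG x)
    (iS.sub iH).integrableOn iG.integrableOn
  have hftc := integral_Ioi_of_hasDerivAt_of_tendsto' (a := 0) (fun x _ => hG x)
    (iS.sub iH).integrableOn hlim
  rw [integral_sub iS.integrableOn iH.integrableOn] at hftc
  have hG0 : G 0 = -(φ 0 / t) := by simp [G, neg_div]
  have hH : |∫ x in Set.Ioi 0, H x| ≤ 2 / t ^ 2 := by
    have iK : Integrable (fun x => (φ x + φ x * x ^ 2) / t ^ 2) := (i0.add i2).div_const _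
    have hφ0 (x : ℝ) : 0 ≤ φ x := gaussianPDFReal_nonneg 0 1 x
    calc |∫ x in Set.Ioi 0, H x| ≤ ∫ x in Set.Ioi 0, |H x| := abs_integral_le_integral_abs
      _ ≤ ∫ x, |H x| := setIntegral_le_integral iH.abs (ae_of_all _ fun x => abs_nonneg _)
      _ ≤ ∫ x, (φ x + φ x * x ^ 2) / t ^ 2 := by
        refine integral_mono iH.abs iK fun x => ?_
        have h1 : |φ x - φ x * x ^ 2| ≤ φ x + φ x * x ^ 2 := by
          have := mul_nonneg (hφ0 x) (sq_nonneg x)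
          rw [abs_le]
          constructor <;> linarith [hφ0 x]
        simp only [H, abs_div, abs_mul, abs_pow, sq_abs]
        gcongr
        exact (mul_le_of_le_one_right (abs_nonneg _) (Real.abs_sin_le_one _)).trans h1
      _ = 2 / t ^ 2 := by
        rw [integral_div, integral_add i0 i2, hφ, integral_gaussianPDFReal_eq_one 0 one_ne_zero]
        have h := integral_gaussianReal_eq_integral_smul (μ := 0) (v := 1) (f := fun x : ℝ => x ^ 2)
          one_ne_zero
        simp only [smul_eq_mul] at h
        rw [← h, integral_sq_gaussianReal]
        norm_num
  have := (abs_le.mp hH).1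
  linarith

lemma integral_sgn_mul_sin_ge {t : ℝ} (ht : 8 ≤ t) :
    1 / (4 * t) ≤ ∫ x, sgn x * Real.sin (t * x) ∂(gaussianReal 0 1) := by
  have ht0 : 0 < t := by linarith
  have heq : ∫ x, sgn x * Real.sin (t * x) ∂(gaussianReal 0 1) =
      2 * ∫ x in Set.Ioi 0, gaussianPDFReal 0 1 x * Real.sin (t * x) := by
    rw [← integral_comp_abs (f := fun x => gaussianPDFReal 0 1 x * Real.sin (t * x)),
      integral_gaussianReal_eq_integral_smul one_ne_zero]
    refine integral_congr_ae (ae_of_all _ fun x => ?_)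
    rcases le_or_gt 0 x with hx | hx
    · simp [sgn, hx, abs_of_nonneg hx]
    · simp [sgn, not_le.mpr hx, abs_of_neg hx, gaussianPDFReal]
  have h0 : (39 / 100 : ℝ) ≤ gaussianPDFReal 0 1 0 := by
    have hle : √(2 * Real.pi) ≤ 100 / 39 := by
      rw [Real.sqrt_le_left (by norm_num)]
      have := Real.pi_lt_d2
      norm_num at this ⊢
      linarith
    have hpos : 0 < √(2 * Real.pi) := Real.sqrt_pos.mpr (by positivity)
    have := inv_anti₀ hpos hle
    norm_num at this
    simpa [gaussianPDFReal] using this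
  have h1 := setIntegral_Ioi_gaussianPDFReal_mul_sin_ge ht0
  rw [heq]
  have h2 : 1 / (4 * t) ≤ 2 * (39 / 100 / t - 2 / t ^ 2) := by
    rw [← sub_nonneg]
    have : 2 * (39 / 100 / t - 2 / t ^ 2) - 1 / (4 * t) = (53 / 100 * t - 4) / t ^ 2 := by
      field_simp
      ring
    rw [this]
    apply div_nonneg _ (by positivity)
    linarith
  have h3 : 39 / 100 / t ≤ gaussianPDFReal 0 1 0 / t := by gcongr
  linarith

lemma abs_sgn (x : ℝ) : |sgn x| = 1 := by
  unfold sgn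
  split_ifs <;> simp

lemma integrable_sgn : Integrable sgn (gaussianReal 0 1) := by
  refine Integrable.of_bound (C := 1) ?_ (ae_of_all _ fun x => (abs_sgn x).le)
  exact (Measurable.ite measurableSet_Ici measurable_const measurable_const).aestronglyMeasurable

lemma one_div_sqrt_le_of_approx {p : Polynomial ℝ} {ε : ℝ} (hε : ε ≤ 1)
    (h : (∫ x, |sgn x - p.eval x| ∂(gaussianReal 0 1)) ≤ ε) {n : ℕ} (hn : p.natDegree < n) :
    1 / (80 * √n) ≤ ε := by
  have hn1 : (1 : ℝ) ≤ n := by exact_mod_cast Nat.one_le_of_lt hn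
  have hs : 1 ≤ √(n : ℝ) := Real.one_le_sqrt.mpr hn1
  have hsq : √(n : ℝ) ^ 2 = n := Real.sq_sqrt (by linarith)
  have ip := integrable_eval_gaussianReal p
  have hd : Integrable (fun x => sgn x - p.eval x) (gaussianReal 0 1) := integrable_sgn.sub ip
  have hp : ∫ x, |p.eval x| ∂(gaussianReal 0 1) ≤ 2 := by
    calc ∫ x, |p.eval x| ∂(gaussianReal 0 1)
        ≤ ∫ x, (1 + |sgn x - p.eval x|) ∂(gaussianReal 0 1) := by
          refine integral_mono ip.abs ((integrable_const _).add hd.abs) fun x => ?_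
          have := abs_sub_abs_le_abs_sub (p.eval x) (sgn x)
          rw [abs_sgn, abs_sub_comm] at this
          simp only
          linarith
      _ = 1 + ∫ x, |sgn x - p.eval x| ∂(gaussianReal 0 1) := by
          rw [integral_add (integrable_const _) hd.abs]
          simp
      _ ≤ 2 := by linarith
  have h1 := abs_integral_eval_mul_sin_le p hn
  have h2 := integral_sgn_mul_sin_ge (t := 8 * √n) (by linarith)
  have h3 : ∫ x, (sgn x - p.eval x) * Real.sin (8 * √n * x) ∂(gaussianReal 0 1) ≤ ε := by
    refine le_trans ?_ h
    refine integral_mono (integrable_mul_sin hd _) hd.abs fun x => ?_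
    refine (le_abs_self _).trans ?_
    rw [abs_mul]
    exact mul_le_of_le_one_right (abs_nonneg _) (Real.abs_sin_le_one _)
  simp_rw [sub_mul] at h3
  rw [integral_sub (integrable_mul_sin integrable_sgn _) (integrable_mul_sin ip _)] at h3
  have h4 : Real.exp (-(15 * n)) ≤ 1 / (125 * √n) := by
    rw [Real.exp_neg, ← one_div]
    apply one_div_le_one_div_of_le (by positivity)
    have h5 := Real.add_one_le_exp (5 * n : ℝ)
    have h6 : Real.exp (15 * n) = Real.exp (5 * n) ^ 3 := by
      rw [← Real.exp_nat_mul]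
      push_cast
      ring_nf
    have h7 : (5 * n : ℝ) ^ 3 ≤ Real.exp (5 * n) ^ 3 := by
      gcongr
      linarith
    have h8 : √(n : ℝ) ≤ n := by nlinarith
    have h9 : (n : ℝ) ≤ n ^ 3 := le_self_pow₀ hn1 (by norm_num)
    rw [h6]
    nlinarith
  have h5 : Real.exp (-(15 * n)) * ∫ x, |p.eval x| ∂(gaussianReal 0 1) ≤
      1 / (125 * √n) * 2 := by gcongr
  have h6 := (le_abs_self _).trans (h1.trans h5)
  have h7 : 1 / (80 * √(n : ℝ)) ≤ 1 / (4 * (8 * √n)) - 1 / (125 * √n) * 2 := by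
    have : 0 < 1 / √(n : ℝ) := by positivity
    have e1 : 1 / (80 * √(n : ℝ)) = 1 / √(n : ℝ) / 80 := by field_simp
    have e2 : 1 / (4 * (8 * √(n : ℝ))) = 1 / √(n : ℝ) / 32 := by field_simp; norm_num
    have e3 : 1 / (125 * √(n : ℝ)) * 2 = 1 / √(n : ℝ) * (2 / 125) := by field_simp
    rw [e1, e2, e3]
    linarith
  linarith

/-- `L¹(γ₁)` degree lower bound for the sign function: there are constants `c, ε₀ > 0`
such that for all `ε ∈ (0, ε₀)`, every polynomial `p` with
`E_{x∼γ₁}[|sign(x) − p(x)|] ≤ ε` has degree at least `c/ε²`. -/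
theorem stmt_18 : ∃ c > (0:ℝ), ∃ ε₀ > (0:ℝ), ∀ ε : ℝ, 0 < ε → ε < ε₀ →
    ∀ p : Polynomial ℝ,
      (∫ x, |sgn x - p.eval x| ∂(gaussianReal 0 1)) ≤ ε →
      c / ε ^ 2 ≤ (p.natDegree : ℝ) := by
  refine ⟨1 / 12800, by norm_num, 1 / 120, by norm_num, fun ε hε hε₀ p h => ?_⟩
  have hmain := one_div_sqrt_le_of_approx (by linarith) h (Nat.lt_succ_self p.natDegree)
  have hpos : (0 : ℝ) < (p.natDegree.succ : ℕ) := by positivity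
  have hs := Real.sqrt_pos.mpr hpos
  have hsq := Real.sq_sqrt hpos.le
  rw [div_le_iff₀ (by positivity)] at hmain ⊢
  have h1 : 1 ≤ 6400 * ε ^ 2 * (p.natDegree.succ : ℕ) := by
    rw [← hsq]
    nlinarith
  push_cast at h1
  nlinarith
end

section
/- Let d be a positive integer and let D be a probability distribution on ℝ with a density g with respect to Lebesgue measure satisfying 0 ≤ g(x) ≤ 2 φ₁(x) for all x ∈ ℝ (where φ₁ is the standard Gaussian density), and whose moments of all orders up to d agree with the corresponding moments of γ₁. Then for every measurable function f : ℝ → [0, 1] and every polynomial p : ℝ → ℝ of degree at most d, E_{x∼γ₁}[f(x)] − E_{x∼D}[f(x)] ≤ E_{x∼γ₁}[|f(x) − p(x)|]. -/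
open MeasureTheory ProbabilityTheory

/-- Every polynomial function is integrable with respect to a real Gaussian measure. -/
lemma integrable_polynomial_eval_gaussianReal (m : ℝ) (v : NNReal) (p : Polynomial ℝ) :
    Integrable (fun x => p.eval x) (gaussianReal m v) := by
  simp only [Polynomial.eval_eq_sum_range]
  refine integrable_finsetSum _ fun i _ => Integrable.const_mul ?_ _
  have h : MemLp id i (gaussianReal m v) := memLp_id_gaussianReal' _ (by simp)
  exact (integrable_norm_iff (by fun_prop)).1 (by simpa only [norm_pow] using! h.integrable_norm_pow')

/-- If `ν ≤ 2 μ`, then integrals against `μ` and `ν` differ by at most the `L¹(μ)` norm. -/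
lemma integral_sub_integral_le_integral_abs {Ω : Type*} [MeasurableSpace Ω] {μ ν : Measure Ω}
    (hle : ν ≤ (2 : ENNReal) • μ) {h : Ω → ℝ} (hμ : Integrable h μ) :
    ∫ x, h x ∂μ - ∫ x, h x ∂ν ≤ ∫ x, |h x| ∂μ := by
  have h2 : Integrable h ((2 : ENNReal) • μ) := hμ.smul_measure (by simp)
  have hν : Integrable h ν := h2.mono_measure hle
  have key : ∫ x, (|h x| - h x) ∂ν ≤ ∫ x, (|h x| - h x) ∂((2 : ENNReal) • μ) :=
    integral_mono_measure hle (.of_forall fun x => sub_nonneg.2 (le_abs_self _)) (h2.abs.sub h2)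
  rw [integral_smul_measure, integral_sub hμ.abs hμ, integral_sub hν.abs hν] at key
  have habs : ∫ x, h x ∂ν ≥ -∫ x, |h x| ∂ν :=
    neg_le_of_abs_le abs_integral_le_integral_abs
  simp only [ENNReal.toReal_ofNat, smul_eq_mul] at key
  linarith

/-- If `D` is a probability distribution on `ℝ` with a Lebesgue density `g ≤ 2φ₁` whose
moments up to order `d` agree with those of `γ₁`, then for every measurable
`f : ℝ → [0,1]` and polynomial `p` of degree at most `d`,
`E_{x∼γ₁}[f(x)] − E_{x∼D}[f(x)] ≤ E_{x∼γ₁}[|f(x) − p(x)|]`. -/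
theorem stmt_19 (d : ℕ) (hd : 0 < d) (D : Measure ℝ) (g : ℝ → ℝ)
    (hDprob : IsProbabilityMeasure D)
    (hg0 : ∀ x, 0 ≤ g x)
    (hgle : ∀ x : ℝ, g x ≤ 2 * ((Real.sqrt (2 * Real.pi))⁻¹ * Real.exp (-(x ^ 2) / 2)))
    (hD : D = volume.withDensity (fun x => ENNReal.ofReal (g x)))
    (hmom : ∀ j : ℕ, j ≤ d → ∫ x, x ^ j ∂D = ∫ x, x ^ j ∂(gaussianReal 0 1))
    (f : ℝ → ℝ) (hf : Measurable f) (hf01 : ∀ x, f x ∈ Set.Icc (0:ℝ) 1)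
    (p : Polynomial ℝ) (hpd : p.natDegree ≤ d) :
    ∫ x, f x ∂(gaussianReal 0 1) - ∫ x, f x ∂D ≤
      ∫ x, |f x - p.eval x| ∂(gaussianReal 0 1) := by
  have hle : D ≤ (2 : ENNReal) • gaussianReal 0 1 := by
    rw [hD, gaussianReal_of_var_ne_zero 0 one_ne_zero, ← withDensity_smul _ (by fun_prop)]
    refine withDensity_mono (.of_forall fun x => ?_)
    refine (ENNReal.ofReal_le_ofReal (hgle x)).trans_eq ?_
    rw [ENNReal.ofReal_mul zero_le_two]
    simp [gaussianPDF, gaussianPDFReal]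
  have hint {h : ℝ → ℝ} (hh : Integrable h (gaussianReal 0 1)) : Integrable h D :=
    (hh.smul_measure (c := 2) (by simp)).mono_measure hle
  have hfi : Integrable f (gaussianReal 0 1) :=
    .of_mem_Icc 0 1 hf.aemeasurable (.of_forall hf01)
  have hpi := integrable_polynomial_eval_gaussianReal 0 1 p
  have hpow (i : ℕ) : Integrable (fun x : ℝ => x ^ i) (gaussianReal 0 1) := by
    simpa using integrable_polynomial_eval_gaussianReal 0 1 (Polynomial.X ^ i)
  have hpeq : ∫ x, p.eval x ∂D = ∫ x, p.eval x ∂(gaussianReal 0 1) := by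
    simp only [Polynomial.eval_eq_sum_range]
    rw [integral_finsetSum _ fun i _ => (hint (hpow i)).const_mul _,
      integral_finsetSum _ fun i _ => (hpow i).const_mul _]
    refine Finset.sum_congr rfl fun i hi => ?_
    rw [integral_const_mul, integral_const_mul,
      hmom i ((Nat.lt_succ_iff.1 (Finset.mem_range.1 hi)).trans hpd)]
  have key := integral_sub_integral_le_integral_abs hle (hfi.sub hpi)
  simp only [Pi.sub_apply] at key
  rw [integral_sub hfi hpi, integral_sub (hint hfi) (hint hpi), hpeq] at key
  linarith
end
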